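/- arXiv:math/0507401 — 3 statements merged into one kernel-verified Lean document; each statement's English description precedes it below -/
import Mathlib

section
/- For every a in the list L = {1, 2, 3, 5, 6, 7, 9, 10, 12, 13, 15, 16, 17, 18, 20, 22, 24, 26, 27, 28, 31, 35, 36, 37, 38, 44, 45, 46, 48, 49, 50, 52, 53, 62, 67, 71, 72, 73, 74, 76, 79, 81, 82, 86, 87, 94, 95, 99, 100, 104, 106, 107, 112, 113, 115, 118, 119, 121, 124, 126, 127, 136, 138, 142, 144, 149, 150, 151, 152, 153, 155, 157, 158, 159, 167, 170, 172, 173, 175, 176, 177, 180, 182, 188, 189, 197, 200, 201, 204, 205, 210, 213, 219, 226, 227, 228, 229, 230, 238, 248, 249, 250, 251, 254, 255, 258, 259, 261, 262, 264, 267, 269, 270, 275, 277, 280, 281, 283, 285, 288, 289, 291, 294, 299}, the number 232·a² + 1 is a prime number. -/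
/-- Euler's list of values `a` with `1 ≤ a ≤ 299` for which `232·a² + 1` is prime. -/
def eulerList : List ℕ :=
  [1, 2, 3, 5, 6, 7, 9, 10, 12, 13, 15, 16, 17, 18, 20, 22, 24, 26, 27, 28, 31, 35,
   36, 37, 38, 44, 45, 46, 48, 49, 50, 52, 53, 62, 67, 71, 72, 73, 74, 76, 79, 81,
   82, 86, 87, 94, 95, 99, 100, 104, 106, 107, 112, 113, 115, 118, 119, 121, 124,
   126, 127, 136, 138, 142, 144, 149, 150, 151, 152, 153, 155, 157, 158, 159, 167,
   170, 172, 173, 175, 176, 177, 180, 182, 188, 189, 197, 200, 201, 204, 205, 210,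
   213, 219, 226, 227, 228, 229, 230, 238, 248, 249, 250, 251, 254, 255, 258, 259,
   261, 262, 264, 267, 269, 270, 275, 277, 280, 281, 283, 285, 288, 289, 291, 294, 299]

/-- The product of the `2 ^ k` consecutive naturals starting at `s`, by binary splitting. -/
def prodConsecutive : ℕ → ℕ → ℕ
  | 0, s => s
  | k + 1, s => prodConsecutive k s * prodConsecutive k (s + 2 ^ k)

theorem dvd_prodConsecutive {d : ℕ} (k s : ℕ) (hs : s ≤ d) (hd : d < s + 2 ^ k) :
    d ∣ prodConsecutive k s := by
  induction k generalizing s with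
  | zero =>
    obtain rfl : d = s := by omega
    exact dvd_rfl
  | succ k ih =>
    rw [prodConsecutive]
    by_cases h : d < s + 2 ^ k
    · exact (ih s hs h).mul_right _
    · exact (ih (s + 2 ^ k) (by omega) (by rw [pow_succ] at hd; omega)).mul_left _

theorem Nat.prime_of_coprime_prodConsecutive {n k : ℕ} (hn : 2 ≤ n) (hk : n < (2 ^ k + 1) ^ 2)
    (h : n.Coprime (prodConsecutive k 1)) : n.Prime := by
  rw [Nat.prime_def_le_sqrt]
  refine ⟨hn, fun d hd hds hdn => ?_⟩
  have hdk : d ≤ 2 ^ k := hds.trans (Nat.lt_succ_iff.mp (Nat.sqrt_lt'.mpr hk))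
  have := Nat.eq_one_of_dvd_coprimes h hdn (dvd_prodConsecutive k 1 (by omega) (by omega))
  omega

theorem euler_list_gives_primes :
    ∀ a ∈ eulerList, Nat.Prime (232 * a ^ 2 + 1) := by
  have h : ∀ a ∈ eulerList,
      0 < a ∧ (232 * a ^ 2 + 1).Coprime (prodConsecutive (a.log2 + 5) 1) := by
    decide +kernel
  intro a ha
  obtain ⟨ha0, hc⟩ := h a ha
  have hlog : a < 2 ^ (a.log2 + 1) := Nat.lt_log2_self
  have hpow : 2 ^ (a.log2 + 5) = 16 * 2 ^ (a.log2 + 1) := by ring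
  exact Nat.prime_of_coprime_prodConsecutive (by nlinarith) (by rw [hpow]; nlinarith) hc
end

section
/- If p is an odd prime and there are nonnegative integers x₁, y₁, x₂, y₂ with p = 232·x₁² + y₁² = 232·x₂² + y₂², then x₁ = x₂ and y₁ = y₂. In other words, an odd prime has at most one representation in the form 232·x² + y² with nonnegative x and y. -/
/-- A multiple `z` of `p` with `n * z ^ 2 ≤ p ^ 2` and `1 < n` vanishes. -/
theorem eq_zero_of_dvd_of_mul_sq_le {n p w z : ℤ} (hn : 1 < n) (hp : 0 < p) (hz : p ∣ z)
    (h : p ^ 2 = w ^ 2 + n * z ^ 2) : z = 0 := by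
  obtain ⟨k, rfl⟩ := hz
  by_contra hne
  have hk : k ≠ 0 := right_ne_zero_of_mul hne
  have hk1 : 0 < k ^ 2 := by positivity
  have hnk : 1 < n * k ^ 2 := by nlinarith
  nlinarith [sq_nonneg w, mul_lt_mul_of_pos_left hnk (pow_pos hp 2)]

/-- For `1 < n`, a prime has at most one representation `n * x ^ 2 + y ^ 2` in natural numbers. -/
theorem Nat.Prime.unique_rep_mul_sq_add_sq {n p : ℕ} (hn : 1 < n) (hp : p.Prime)
    {x₁ y₁ x₂ y₂ : ℕ} (h₁ : p = n * x₁ ^ 2 + y₁ ^ 2) (h₂ : p = n * x₂ ^ 2 + y₂ ^ 2) :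
    x₁ = x₂ ∧ y₁ = y₂ := by
  have hn' : (1 : ℤ) < n := by exact_mod_cast hn
  have hp0 : (0 : ℤ) < p := by exact_mod_cast hp.pos
  have e₁ : (p : ℤ) = n * x₁ ^ 2 + y₁ ^ 2 := by exact_mod_cast h₁
  have e₂ : (p : ℤ) = n * x₂ ^ 2 + y₂ ^ 2 := by exact_mod_cast h₂
  have hdvd : (p : ℤ) ∣ (x₁ * y₂ - x₂ * y₁) * (x₁ * y₂ + x₂ * y₁) :=
    ⟨x₁ ^ 2 - x₂ ^ 2, by linear_combination (x₂ : ℤ) ^ 2 * e₁ - (x₁ : ℤ) ^ 2 * e₂⟩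
  have hcross : (x₁ * y₂ : ℤ) = x₂ * y₁ := by
    rcases (Nat.prime_iff_prime_int.mp hp).dvd_or_dvd hdvd with h | h
    · have := eq_zero_of_dvd_of_mul_sq_le (w := n * x₁ * x₂ + y₁ * y₂) hn' hp0 h (by
        linear_combination (p : ℤ) * e₁ + (n * x₁ ^ 2 + y₁ ^ 2 : ℤ) * e₂)
      linarith
    · have := eq_zero_of_dvd_of_mul_sq_le (w := n * x₁ * x₂ - y₁ * y₂) hn' hp0 h (by
        linear_combination (p : ℤ) * e₁ + (n * x₁ ^ 2 + y₁ ^ 2 : ℤ) * e₂)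
      have ha : (0 : ℤ) ≤ x₁ * y₂ := by positivity
      have hb : (0 : ℤ) ≤ x₂ * y₁ := by positivity
      linarith
  have hsq : (x₁ : ℤ) ^ 2 = x₂ ^ 2 := mul_left_cancel₀ hp0.ne' (by
    linear_combination (x₁ : ℤ) ^ 2 * e₂ - (x₂ : ℤ) ^ 2 * e₁ +
      (x₁ * y₂ + x₂ * y₁ : ℤ) * hcross)
  have hx : x₁ = x₂ := Nat.pow_left_injective two_ne_zero (by exact_mod_cast hsq)
  subst hx
  exact ⟨rfl, Nat.pow_left_injective two_ne_zero (Nat.add_left_cancel (h₁.symm.trans h₂))⟩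

theorem odd_prime_unique_rep_232 (p : ℕ) (hp : p.Prime) (hodd : Odd p)
    (x₁ y₁ x₂ y₂ : ℕ)
    (h₁ : p = 232 * x₁ ^ 2 + y₁ ^ 2) (h₂ : p = 232 * x₂ ^ 2 + y₂ ^ 2) :
    x₁ = x₂ ∧ y₁ = y₂ :=
  hp.unique_rep_mul_sq_add_sq (by norm_num) h₁ h₂
end

section
/- Let z, r, s be positive integers with r ≥ s, r ≡ s (mod 2), and 2·r·s = z·(29z + 1). Set a = (r + s)/2, x = (r − s)/2, and y = 58z + 1. Then 232·a² + 1 = 232·x² + y² and x < a. -/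
theorem factorization_gives_exclusion (z r s : ℕ) (hz : 0 < z) (hr : 0 < r)
    (hs : 0 < s) (hrs : s ≤ r) (hpar : r % 2 = s % 2)
    (hfac : 2 * (r * s) = z * (29 * z + 1))
    (a x y : ℕ) (ha : a = (r + s) / 2) (hx : x = (r - s) / 2) (hy : y = 58 * z + 1) :
    232 * a ^ 2 + 1 = 232 * x ^ 2 + y ^ 2 ∧ x < a := by
  have hr_eq : r = s + 2 * x := by omega
  have ha_eq : a = s + x := by omega
  refine ⟨?_, by omega⟩
  subst hr_eq ha_eq hy
  linear_combination 116 * hfac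
end
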